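/- Let Σ = {a, b, c, p₀, p₁, p₂} and let R be the hedge rewriting system with the four rules p₀(x) → a·p₁(x), p₁(x) → p₂(x)·c, p₂(x) → p₀(b(x)), p₂(x) → b(x). Then the set of trees t ∈ T(Σ) such that p₀(ε) →*_R t and t contains no occurrence of p₀, p₁ or p₂ is exactly the set of T-patterns: the trees bⁿ placed in context a·…·a·[ ]·c·…·c, i.e., the hedges consisting of n leaf trees a(ε), followed by the nested tree bⁿ, followed by n leaf trees c(ε), for n ≥ 1 — the trees with equal numbers of a's, b's and c's of this shape. (Here a hedge of length one is identified with a tree: the reachable trees without p₀, p₁, p₂ never arise; the reachable hedges without p₀, p₁, p₂ are exactly the T-patterns.) -/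

import Mathlib

/-- Unranked trees over alphabet `α`, with variables indexed by `ℕ` at leaves. -/
inductive VTree (α : Type) : Type where
  | var : ℕ → VTree α
  | node : α → List (VTree α) → VTree α

/-- A hedge is a finite sequence of trees. -/
abbrev VHedge (α : Type) := List (VTree α)

/-- Relabeling of trees. -/
def VTree.map {α β : Type} (f : α → β) : VTree α → VTree β
  | .var x => .var x
  | .node a ts => .node (f a) (ts.attach.map fun t => t.1.map f)
decreasing_by
  have := List.sizeOf_lt_of_mem t.2
  simp only [VTree.node.sizeOf_spec]
  omega

/-- Relabeling of hedges. -/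
def hedgeMap {α β : Type} (f : α → β) (h : VHedge α) : VHedge β := h.map (VTree.map f)

/-- A tree is ground if it contains no variable. -/
inductive GroundT {α : Type} : VTree α → Prop where
  | node {a : α} {ts : List (VTree α)} : (∀ t ∈ ts, GroundT t) → GroundT (.node a ts)

/-- A hedge is ground (an element of `H(Σ)`) if all its trees are ground. -/
def Ground {α : Type} (h : VHedge α) : Prop := ∀ t ∈ h, GroundT t

/-- Application of a substitution `σ : X → H(Σ, X)` to a tree, yielding a hedge
(a variable leaf is replaced by the hedge `σ x`). -/
def substT {α : Type} (σ : ℕ → VHedge α) : VTree α → VHedge α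
  | .var x => σ x
  | .node a ts => [.node a ((ts.attach.map fun t => substT σ t.1).flatten)]
decreasing_by
  have := List.sizeOf_lt_of_mem t.2
  simp only [VTree.node.sizeOf_spec]
  omega

/-- Application of a substitution to a hedge. -/
def substH {α : Type} (σ : ℕ → VHedge α) (h : VHedge α) : VHedge α :=
  (h.map (substT σ)).flatten

/-- The rewrite relation of a hedge rewriting system `R`: the smallest relation
containing `R` that is closed under application of substitutions and contexts. -/
inductive HRew {α : Type} (R : Set (VHedge α × VHedge α)) :
    VHedge α → VHedge α → Prop where
  | base {l r : VHedge α} (σ : ℕ → VHedge α) :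
      (l, r) ∈ R → HRew R (substH σ l) (substH σ r)
  | ctx_hor {h h' : VHedge α} (pre post : VHedge α) :
      HRew R h h' → HRew R (pre ++ h ++ post) (pre ++ h' ++ post)
  | ctx_ver {h h' : VHedge α} (a : α) :
      HRew R h h' → HRew R [.node a h] [.node a h']

/-- `post*_R(L)`: the forward rewrite closure of `L` under `R`. -/
def postStar {α : Type} (R : Set (VHedge α × VHedge α)) (L : Set (VHedge α)) :
    Set (VHedge α) :=
  { h' | ∃ h ∈ L, Relation.ReflTransGen (HRew R) h h' }


/-- The alphabet `Σ = {a, b, c, p₀, p₁, p₂}`. -/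
inductive S6 : Type where
  | a : S6
  | b : S6
  | c : S6
  | p0 : S6
  | p1 : S6
  | p2 : S6
deriving DecidableEq

/-- The HRS `R = { p₀(x) → a·p₁(x), p₁(x) → p₂(x)·c, p₂(x) → p₀(b(x)),
p₂(x) → b(x) }`. -/
def R10 : Set (VHedge S6 × VHedge S6) :=
  { ([VTree.node .p0 [VTree.var 0]],
     [VTree.node .a [], VTree.node .p1 [VTree.var 0]]),
    ([VTree.node .p1 [VTree.var 0]],
     [VTree.node .p2 [VTree.var 0], VTree.node .c []]),
    ([VTree.node .p2 [VTree.var 0]],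
     [VTree.node .p0 [VTree.node .b [VTree.var 0]]]),
    ([VTree.node .p2 [VTree.var 0]],
     [VTree.node .b [VTree.var 0]]) }

/-- `HasLabel a t` holds iff the symbol `a` occurs (as a node label) in `t`. -/
inductive HasLabel (a : S6) : VTree S6 → Prop where
  | here (ts : List (VTree S6)) : HasLabel a (.node a ts)
  | child {b : S6} {ts : List (VTree S6)} {t : VTree S6} :
      t ∈ ts → HasLabel a t → HasLabel a (.node b ts)

/-- `bpow6 n` is the nested tree `b^{n+1}` over `S6`. -/
def bpow6 : ℕ → VTree S6
  | 0 => .node .b []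
  | n + 1 => .node .b [bpow6 n]

/-- The hedge of children of `bpow6 n`. -/
def bchildren : ℕ → VHedge S6
  | 0 => []
  | n + 1 => [bpow6 n]

theorem bpow6_eq_node (n : ℕ) : bpow6 n = .node .b (bchildren n) := by
  cases n <;> rfl

theorem bchildren_succ (n : ℕ) : bchildren (n + 1) = [.node .b (bchildren n)] := by
  rw [bchildren, bpow6_eq_node]

/-- The tree `t` contains one of the symbols `p₀, p₁, p₂`. -/
def HasP (t : VTree S6) : Prop := HasLabel .p0 t ∨ HasLabel .p1 t ∨ HasLabel .p2 t

theorem hasP_node {s : S6} {ts : VHedge S6} :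
    HasP (.node s ts) ↔ (s = .p0 ∨ s = .p1 ∨ s = .p2) ∨ ∃ t ∈ ts, HasP t := by
  have key (q : S6) : HasLabel q (.node s ts) ↔ s = q ∨ ∃ t ∈ ts, HasLabel q t := by
    constructor
    · intro h
      cases h with
      | here => exact .inl rfl
      | child ht h => exact .inr ⟨_, ht, h⟩
    · rintro (rfl | ⟨t, ht, h⟩)
      · exact .here _
      · exact .child ht h
  simp only [HasP, key]
  grind

theorem not_hasP_bpow6 (n : ℕ) : ¬ HasP (bpow6 n) := by
  induction n with
  | zero => simp [bpow6, hasP_node]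
  | succ n ih => simp [bpow6, hasP_node, ih]

theorem not_hasP_bchildren (n : ℕ) : ∀ t ∈ bchildren n, ¬ HasP t := by
  cases n <;> simp [bchildren, not_hasP_bpow6]

/-- Rewriting by `R10` of a single tree to a hedge: a rule applied at the root, or a rewrite step
among the children. -/
inductive TreeStep : VTree S6 → VHedge S6 → Prop where
  | p0 (x : VHedge S6) : TreeStep (.node .p0 x) [.node .a [], .node .p1 x]
  | p1 (x : VHedge S6) : TreeStep (.node .p1 x) [.node .p2 x, .node .c []]
  | p2_p0 (x : VHedge S6) : TreeStep (.node .p2 x) [.node .p0 [.node .b x]]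
  | p2_b (x : VHedge S6) : TreeStep (.node .p2 x) [.node .b x]
  | child (s : S6) {g g' : VHedge S6} : HRew R10 g g' → TreeStep (.node s g) [.node s g']

theorem TreeStep.hrew {t : VTree S6} {r : VHedge S6} (h : TreeStep t r) : HRew R10 [t] r := by
  cases h with
  | p0 x =>
    simpa [substH, substT] using HRew.base (R := R10) (fun _ => x) (.inl rfl)
  | p1 x =>
    simpa [substH, substT] using HRew.base (R := R10) (fun _ => x) (.inr (.inl rfl))
  | p2_p0 x =>
    simpa [substH, substT] using HRew.base (R := R10) (fun _ => x) (.inr (.inr (.inl rfl)))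
  | p2_b x =>
    simpa [substH, substT] using HRew.base (R := R10) (fun _ => x) (.inr (.inr (.inr rfl)))
  | child s hg => exact .ctx_ver s hg

theorem TreeStep.hrew_append {t : VTree S6} {r : VHedge S6} (h : TreeStep t r)
    (pre post : VHedge S6) : HRew R10 (pre ++ t :: post) (pre ++ r ++ post) := by
  simpa using HRew.ctx_hor pre post h.hrew

theorem HRew.exists_treeStep {h h' : VHedge S6} (H : HRew R10 h h') :
    ∃ pre t post r, TreeStep t r ∧ h = pre ++ t :: post ∧ h' = pre ++ r ++ post := by
  induction H with
  | base σ hlr =>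
    suffices ∃ t r, TreeStep t r ∧ substH σ _ = [t] ∧ substH σ _ = r by
      obtain ⟨t, r, hs, hl, hr⟩ := this
      exact ⟨[], t, [], r, hs, by simpa using hl, by simpa using hr⟩
    rcases hlr with h | h | h | h <;> cases h
    · exact ⟨_, _, .p0 (σ 0), by simp [substH, substT], by simp [substH, substT]⟩
    · exact ⟨_, _, .p1 (σ 0), by simp [substH, substT], by simp [substH, substT]⟩
    · exact ⟨_, _, .p2_p0 (σ 0), by simp [substH, substT], by simp [substH, substT]⟩
    · exact ⟨_, _, .p2_b (σ 0), by simp [substH, substT], by simp [substH, substT]⟩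
  | ctx_hor pre post _ ih =>
    obtain ⟨pre', t, post', r, hs, rfl, rfl⟩ := ih
    exact ⟨pre ++ pre', t, post' ++ post, r, hs, by simp, by simp⟩
  | ctx_ver s H _ => exact ⟨[], _, [], _, .child s H, rfl, rfl⟩

theorem HRew.exists_hasP {h h' : VHedge S6} (H : HRew R10 h h') : ∃ t ∈ h, HasP t := by
  induction H with
  | base σ hlr =>
    rcases hlr with h | h | h | h <;> cases h <;> simp [substH, substT, hasP_node]
  | ctx_hor pre post _ ih =>
    obtain ⟨t, ht, hp⟩ := ih
    exact ⟨t, by simp [ht], hp⟩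
  | ctx_ver s _ ih => simpa [hasP_node] using .inr ih

theorem TreeStep.hasP {t : VTree S6} {r : VHedge S6} (h : TreeStep t r) : HasP t := by
  simpa using h.hrew.exists_hasP

/-- The hedge `aⁱ · t · cʲ`. -/
def wrap (i j : ℕ) (t : VTree S6) : VHedge S6 :=
  List.replicate i (.node .a []) ++ t :: List.replicate j (.node .c [])

theorem mem_wrap (i j : ℕ) (t : VTree S6) : t ∈ wrap i j t := by
  simp [wrap]

theorem HRew.wrap_inv {i j : ℕ} {t : VTree S6} {h : VHedge S6} (H : HRew R10 (wrap i j t) h) :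
    ∃ r, TreeStep t r ∧
      h = List.replicate i (.node .a []) ++ r ++ List.replicate j (.node .c []) := by
  obtain ⟨pre, t', post, r, hs, heq, rfl⟩ := H.exists_treeStep
  have hp := hs.hasP
  rw [wrap, List.append_cons_inj_of_notMem] at heq
  · obtain ⟨rfl, rfl, rfl⟩ := heq
    exact ⟨r, hs, rfl⟩
  all_goals
    intro hm
    rw [List.eq_of_mem_replicate hm] at hp
    simp [hasP_node] at hp

/-- The hedges reachable from `p₀(ε)` by `R10`. -/
inductive Reach : VHedge S6 → Prop where
  | p0 (n : ℕ) : Reach (wrap n n (.node .p0 (bchildren n)))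
  | p1 (n : ℕ) : Reach (wrap (n + 1) n (.node .p1 (bchildren n)))
  | p2 (n : ℕ) : Reach (wrap (n + 1) (n + 1) (.node .p2 (bchildren n)))
  | b (n : ℕ) : Reach (wrap (n + 1) (n + 1) (.node .b (bchildren n)))

theorem not_hrew_bchildren {n : ℕ} {g : VHedge S6} : ¬ HRew R10 (bchildren n) g := by
  intro H
  obtain ⟨t, ht, hp⟩ := H.exists_hasP
  exact not_hasP_bchildren n t ht hp

theorem Reach.step {h h' : VHedge S6} (hr : Reach h) (H : HRew R10 h h') : Reach h' := by
  cases hr with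
  | p0 n =>
    obtain ⟨r, hs, rfl⟩ := H.wrap_inv
    cases hs with
    | p0 => simpa [wrap, List.replicate_succ'] using Reach.p1 n
    | child _ hg => exact (not_hrew_bchildren hg).elim
  | p1 n =>
    obtain ⟨r, hs, rfl⟩ := H.wrap_inv
    cases hs with
    | p1 => simpa [wrap, List.replicate_succ (n := n) (a := VTree.node S6.c [])] using Reach.p2 n
    | child _ hg => exact (not_hrew_bchildren hg).elim
  | p2 n =>
    obtain ⟨r, hs, rfl⟩ := H.wrap_inv
    cases hs with
    | p2_p0 => simpa [wrap, bchildren_succ] using Reach.p0 (n + 1)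
    | p2_b => simpa [wrap] using Reach.b n
    | child _ hg => exact (not_hrew_bchildren hg).elim
  | b n =>
    obtain ⟨r, hs, rfl⟩ := H.wrap_inv
    cases hs with
    | child _ hg => exact (not_hrew_bchildren hg).elim

theorem reach_of_reflTransGen {h : VHedge S6}
    (H : Relation.ReflTransGen (HRew R10) [VTree.node .p0 []] h) : Reach h := by
  induction H with
  | refl => exact .p0 0
  | tail _ hs ih => exact ih.step hs

theorem reflTransGen_p0_p2 (n : ℕ) :
    Relation.ReflTransGen (HRew R10) (wrap n n (.node .p0 (bchildren n)))
      (wrap (n + 1) (n + 1) (.node .p2 (bchildren n))) := by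
  refine .tail (.single (b := wrap (n + 1) n (.node .p1 (bchildren n))) ?_) ?_
  · simpa [wrap, List.replicate_succ'] using (TreeStep.p0 (bchildren n)).hrew_append
      (List.replicate n (.node .a [])) (List.replicate n (.node .c []))
  · simpa [wrap, List.replicate_succ (n := n) (a := VTree.node S6.c [])] using
      (TreeStep.p1 (bchildren n)).hrew_append
        (List.replicate (n + 1) (.node .a [])) (List.replicate n (.node .c []))

theorem reflTransGen_p0 (n : ℕ) :
    Relation.ReflTransGen (HRew R10) [VTree.node .p0 []]
      (wrap n n (.node .p0 (bchildren n))) := by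
  induction n with
  | zero => exact .refl
  | succ n ih =>
    refine (ih.trans (reflTransGen_p0_p2 n)).tail ?_
    simpa [wrap, bchildren_succ] using (TreeStep.p2_p0 (bchildren n)).hrew_append
      (List.replicate (n + 1) (.node .a [])) (List.replicate (n + 1) (.node .c []))

/-- The hedges reachable from `p₀(ε)` by `R` that contain no occurrence of
`p₀, p₁, p₂` are exactly the T-patterns `aⁿ · bⁿ · cⁿ` (`n ≥ 1`). -/
theorem reachable_without_p_eq_tpatterns :
    { h : VHedge S6 |
        Relation.ReflTransGen (HRew R10) [VTree.node .p0 []] h ∧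
        ∀ t ∈ h, ¬ HasLabel .p0 t ∧ ¬ HasLabel .p1 t ∧ ¬ HasLabel .p2 t } =
    { h | ∃ n : ℕ,
        h = List.replicate (n + 1) (VTree.node S6.a []) ++ [bpow6 n] ++
            List.replicate (n + 1) (VTree.node S6.c []) } := by
  ext h
  simp only [Set.mem_ofPred_eq]
  constructor
  · rintro ⟨H, hp⟩
    replace hp : ∀ t ∈ h, ¬ HasP t := fun t ht => by simpa [HasP] using hp t ht
    cases reach_of_reflTransGen H with
    | b n => exact ⟨n, by simp [wrap, bpow6_eq_node]⟩
    | _ n => exact (hp _ (mem_wrap _ _ _) (hasP_node.2 (.inl (by simp)))).elim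
  · rintro ⟨n, rfl⟩
    constructor
    · refine ((reflTransGen_p0 n).trans (reflTransGen_p0_p2 n)).tail ?_
      simpa [wrap, bpow6_eq_node] using (TreeStep.p2_b (bchildren n)).hrew_append
        (List.replicate (n + 1) (.node .a [])) (List.replicate (n + 1) (.node .c []))
    · intro t ht
      suffices ¬ HasP t by simpa [HasP] using this
      simp only [List.mem_append, List.mem_replicate, List.mem_singleton] at ht
      rcases ht with (⟨-, rfl⟩ | rfl) | ⟨-, rfl⟩
      · simp [hasP_node]
      · exact not_hasP_bpow6 n
      · simp [hasP_node]
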